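/- arXiv:2409.09505 — 3 statements merged into one kernel-verified Lean document; each statement's English description precedes it below -/
import Mathlib

section
/- Let N ≥ 2 be an integer and let t₁, ..., t_N be pairwise distinct complex numbers. The Garnier hamiltonians G_i := ∑_{j≠i} p_i p_j (y_i − y_j)² / (t_j − t_i), regarded as elements of the polynomial ring ℂ[y₁,...,y_N, p₁,...,p_N], pairwise Poisson-commute: {G_i, G_j} = 0 for all i, j ∈ {1,...,N}. -/
open MvPolynomial

/-- Variables of the polynomial ring ℂ[y₁,...,y_N,p₁,...,p_N]: `Sum.inl k` is `y_k`,
`Sum.inr k` is `p_k`. -/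
abbrev GarnierRing (N : ℕ) := MvPolynomial (Fin N ⊕ Fin N) ℂ

/-- The Poisson bracket {F,G} = ∑_k (∂F/∂p_k · ∂G/∂y_k − ∂F/∂y_k · ∂G/∂p_k). -/
noncomputable def poissonBracket {N : ℕ} (F G : GarnierRing N) : GarnierRing N :=
  ∑ k : Fin N,
    (pderiv (Sum.inr k) F * pderiv (Sum.inl k) G -
      pderiv (Sum.inl k) F * pderiv (Sum.inr k) G)

/-- The Garnier hamiltonian G_i = ∑_{j≠i} p_i p_j (y_i − y_j)² / (t_j − t_i). -/
noncomputable def garnierHam {N : ℕ} (t : Fin N → ℂ) (i : Fin N) : GarnierRing N :=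
  ∑ j ∈ Finset.univ.erase i,
    C ((t j - t i)⁻¹) *
      (X (Sum.inr i) * X (Sum.inr j) * (X (Sum.inl i) - X (Sum.inl j)) ^ 2)

/-- The polynomial `p_a p_b (y_a − y_b)²`. -/
noncomputable def garnierPair {N : ℕ} (a b : Fin N) : GarnierRing N :=
  X (Sum.inr a) * X (Sum.inr b) * (X (Sum.inl a) - X (Sum.inl b)) ^ 2

/-- The polynomial `2 p_a p_b p_c (y_a − y_b) (y_a − y_c) (y_c − y_b)`, which is the bracket of
`garnierPair a b` and `garnierPair a c` for distinct indices. -/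
noncomputable def garnierTriple {N : ℕ} (a b c : Fin N) : GarnierRing N :=
  2 * X (Sum.inr a) * X (Sum.inr b) * X (Sum.inr c) * (X (Sum.inl a) - X (Sum.inl b)) *
    (X (Sum.inl a) - X (Sum.inl c)) * (X (Sum.inl c) - X (Sum.inl b))

theorem poissonBracket_self {N : ℕ} (F : GarnierRing N) : poissonBracket F F = 0 :=
  Finset.sum_eq_zero fun _ _ => by ring

theorem poissonBracket_sum_C_mul {N : ℕ} {ι κ : Type*} (s : Finset ι) (u : Finset κ)
    (c : ι → ℂ) (d : κ → ℂ) (F : ι → GarnierRing N) (G : κ → GarnierRing N) :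
    poissonBracket (∑ k ∈ s, C (c k) * F k) (∑ l ∈ u, C (d l) * G l) =
      ∑ k ∈ s, ∑ l ∈ u, C (c k * d l) * poissonBracket (F k) (G l) := by
  simp only [poissonBracket, map_sum, pderiv_C_mul, Finset.sum_mul_sum]
  simp only [← Finset.sum_sub_distrib, Finset.mul_sum]
  rw [Finset.sum_comm]
  refine Finset.sum_congr rfl fun k _ => ?_
  rw [Finset.sum_comm]
  refine Finset.sum_congr rfl fun l _ => Finset.sum_congr rfl fun m _ => ?_
  rw [C_mul]
  ring

theorem pderiv_inr_garnierPair {N : ℕ} (a b m : Fin N) :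
    pderiv (Sum.inr m) (garnierPair a b) =
      ((if a = m then X (Sum.inr b) else 0) + (if b = m then X (Sum.inr a) else 0)) *
        (X (Sum.inl a) - X (Sum.inl b)) ^ 2 := by
  simp only [garnierPair, Derivation.leibniz, Derivation.leibniz_pow, map_sub, pderiv_X,
    Pi.single_apply, smul_eq_mul, Sum.inr.injEq, reduceCtorEq, if_false]
  split_ifs <;> simp <;> ring

theorem pderiv_inl_garnierPair {N : ℕ} (a b m : Fin N) :
    pderiv (Sum.inl m) (garnierPair a b) =
      ((if a = m then 1 else 0) - (if b = m then 1 else 0)) *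
        (2 * X (Sum.inr a) * X (Sum.inr b) * (X (Sum.inl a) - X (Sum.inl b))) := by
  simp only [garnierPair, Derivation.leibniz, Derivation.leibniz_pow, map_sub, pderiv_X,
    Pi.single_apply, smul_eq_mul, Sum.inl.injEq, reduceCtorEq, if_false]
  split_ifs <;> simp <;> ring

theorem poissonBracket_garnierPair {N : ℕ} (a b c d : Fin N) :
    poissonBracket (garnierPair a b) (garnierPair c d) =
      (if a = c then garnierTriple a b d else 0) + (if a = d then garnierTriple a b c else 0) +
        (if b = c then garnierTriple b a d else 0) +
        (if b = d then garnierTriple b a c else 0) := by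
  have expand : ∀ m : Fin N,
      pderiv (Sum.inr m) (garnierPair a b) * pderiv (Sum.inl m) (garnierPair c d) -
        pderiv (Sum.inl m) (garnierPair a b) * pderiv (Sum.inr m) (garnierPair c d) =
      (if a = m then (if a = c then garnierTriple a b d else 0) +
        (if a = d then garnierTriple a b c else 0) else 0) +
      (if b = m then (if b = c then garnierTriple b a d else 0) +
        (if b = d then garnierTriple b a c else 0) else 0) := by
    intro m
    rw [pderiv_inr_garnierPair, pderiv_inl_garnierPair, pderiv_inr_garnierPair,
      pderiv_inl_garnierPair]
    have hmc : (m = c) = (c = m) := propext eq_comm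
    have hmd : (m = d) = (d = m) := propext eq_comm
    by_cases ha : a = m <;> by_cases hb : b = m <;> by_cases hc : c = m <;>
      by_cases hd : d = m <;>
      simp only [garnierTriple, ha, hb, hc, hd, hmc, hmd, if_true, if_false] <;> ring
  rw [poissonBracket, Finset.sum_congr rfl fun m _ => expand m, Finset.sum_add_distrib]
  simp [add_assoc]

theorem garnierHam_eq_sum {N : ℕ} (t : Fin N → ℂ) (i : Fin N) :
    garnierHam t i = ∑ j, C ((t j - t i)⁻¹) * garnierPair i j :=
  Finset.sum_erase _ (by simp)

theorem inv_sub_mul_inv_sub_cyclic {K : Type*} [Field K] {x y z : K}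
    (hxy : x ≠ y) (hzx : z ≠ x) (hzy : z ≠ y) :
    (z - x)⁻¹ * (z - y)⁻¹ = (z - x)⁻¹ * (x - y)⁻¹ + (y - x)⁻¹ * (z - y)⁻¹ := by
  have h₁ := sub_ne_zero.2 hxy
  have h₂ := sub_ne_zero.2 hzx
  have h₃ := sub_ne_zero.2 hzy
  rw [← neg_sub x y]
  field_simp
  ring

theorem garnier_poisson_commute (N : ℕ) (hN : 2 ≤ N) (t : Fin N → ℂ)
    (ht : Function.Injective t) (i j : Fin N) :
    poissonBracket (garnierHam t i) (garnierHam t j) = 0 := by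
  rcases eq_or_ne i j with rfl | hij
  · exact poissonBracket_self _
  rw [garnierHam_eq_sum, garnierHam_eq_sum, poissonBracket_sum_C_mul]
  simp only [poissonBracket_garnierPair, if_neg hij, zero_add, mul_add, mul_ite, mul_zero,
    Finset.sum_add_distrib, Finset.sum_ite_eq, Finset.mem_univ, if_true]
  rw [Finset.sum_comm (f := fun k l => if k = j then _ else _)]
  simp only [Finset.sum_ite_eq', Finset.mem_univ, if_true, ← Finset.sum_add_distrib]
  refine Finset.sum_eq_zero fun k _ => ?_
  rcases eq_or_ne k i with rfl | hki
  · simp [garnierTriple]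
  rcases eq_or_ne k j with rfl | hkj
  · simp [garnierTriple]
  rw [inv_sub_mul_inv_sub_cyclic (ht.ne hij) (ht.ne hki) (ht.ne hkj), C_add]
  simp only [garnierTriple]
  ring
end

section
/- Let N ≥ 2 be an integer and let t₁, ..., t_N be pairwise distinct complex numbers, with Garnier hamiltonians G_i := ∑_{j≠i} p_i p_j (y_i − y_j)² / (t_j − t_i). For every point (y, p) ∈ ℂ^N × ℂ^N satisfying ∑_{i=1}^N p_i = 0, ∑_{i=1}^N p_i y_i = 0, and ∑_{i=1}^N p_i y_i² = 0, the values of the Garnier hamiltonians at (y,p) satisfy the three linear relations ∑_{i=1}^N G_i(y,p) = 0, ∑_{i=1}^N t_i G_i(y,p) = 0, and ∑_{i=1}^N t_i² G_i(y,p) = 0. -/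
open MvPolynomial

/-- Evaluation of a polynomial in ℂ[y,p] at the point (y,p) ∈ ℂ^N × ℂ^N. -/
noncomputable def evalYP {N : ℕ} (y p : Fin N → ℂ) (F : GarnierRing N) : ℂ :=
  eval (Sum.elim y p) F

theorem evalYP_garnierHam {N : ℕ} (t y p : Fin N → ℂ) (i : Fin N) :
    evalYP y p (garnierHam t i) =
      ∑ j, (t j - t i)⁻¹ * (p i * p j * (y i - y j) ^ 2) := by
  rw [← Finset.add_sum_erase _ _ (Finset.mem_univ i)]
  simp [evalYP, garnierHam]

/-- The quadratic form `∑ p_i p_j (y_i - y_j)²` has vanishing rows on the common zero locus of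
the three moments of `y` with weights `p`. -/
theorem sum_mul_sub_sq_eq_zero {N : ℕ} (y p : Fin N → ℂ)
    (h0 : ∑ i, p i = 0) (h1 : ∑ i, p i * y i = 0) (h2 : ∑ i, p i * (y i) ^ 2 = 0) (i : Fin N) :
    ∑ j, p i * p j * (y i - y j) ^ 2 = 0 := by
  calc ∑ j, p i * p j * (y i - y j) ^ 2
      = ∑ j, (p i * y i ^ 2 * p j - 2 * p i * y i * (p j * y j) + p i * (p j * y j ^ 2)) :=
        Finset.sum_congr rfl fun j _ => by ring
    _ = 0 := by
        rw [Finset.sum_add_distrib, Finset.sum_sub_distrib, ← Finset.mul_sum, ← Finset.mul_sum,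
          ← Finset.mul_sum, h0, h1, h2]
        ring

/-- A weighted sum of the Garnier hamiltonians vanishes on the zero locus of the moments as soon
as the divided differences of the weight split as a sum `g i + g j`. -/
theorem sum_mul_garnierHam_eq_zero {N : ℕ} (t : Fin N → ℂ) (ht : Function.Injective t)
    (y p : Fin N → ℂ) (h0 : ∑ i, p i = 0) (h1 : ∑ i, p i * y i = 0)
    (h2 : ∑ i, p i * (y i) ^ 2 = 0) (f g : Fin N → ℂ)
    (hfg : ∀ i j, f i - f j = (t j - t i) * (g i + g j)) :
    ∑ i, f i * evalYP y p (garnierHam t i) = 0 := by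
  set a : Fin N → Fin N → ℂ := fun i j => p i * p j * (y i - y j) ^ 2 with ha
  have row : ∀ i, ∑ j, a i j = 0 := sum_mul_sub_sq_eq_zero y p h0 h1 h2
  have symm : ∀ i j, a i j = a j i := fun i j => by simp only [ha]; ring
  have hS : ∑ i, f i * evalYP y p (garnierHam t i)
      = ∑ i, ∑ j, f i * ((t j - t i)⁻¹ * a i j) := by
    simp only [evalYP_garnierHam, Finset.mul_sum, ha]
  have hS' : ∑ i, f i * evalYP y p (garnierHam t i)
      = ∑ i, ∑ j, f j * ((t i - t j)⁻¹ * a j i) := by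
    rw [hS, Finset.sum_comm]
  have hrow : ∑ i, ∑ j, g i * a i j = 0 := by
    simp only [← Finset.mul_sum, row, mul_zero, Finset.sum_const_zero]
  have hcol : ∑ i, ∑ j, g j * a i j = 0 := by
    rw [Finset.sum_comm]
    rw [← hrow]
    exact Finset.sum_congr rfl fun i _ => Finset.sum_congr rfl fun j _ => by rw [symm j i]
  have hdouble : ∑ i, f i * evalYP y p (garnierHam t i)
      + ∑ i, f i * evalYP y p (garnierHam t i) = 0 := by
    nth_rewrite 1 [hS]
    rw [hS', ← Finset.sum_add_distrib]
    simp only [← Finset.sum_add_distrib]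
    calc ∑ i, ∑ j, (f i * ((t j - t i)⁻¹ * a i j) + f j * ((t i - t j)⁻¹ * a j i))
        = ∑ i, ∑ j, (g i * a i j + g j * a i j) := by
          refine Finset.sum_congr rfl fun i _ => Finset.sum_congr rfl fun j _ => ?_
          rcases eq_or_ne i j with rfl | hij
          · simp [ha]
          · have hne : t j - t i ≠ 0 := sub_ne_zero.mpr fun h => hij (ht h).symm
            rw [symm j i, ← neg_sub (t j) (t i), inv_neg]
            calc f i * ((t j - t i)⁻¹ * a i j) + f j * (-(t j - t i)⁻¹ * a i j)
                = (f i - f j) * (t j - t i)⁻¹ * a i j := by ring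
              _ = g i * a i j + g j * a i j := by
                rw [hfg]
                field_simp
      _ = 0 := by simp only [Finset.sum_add_distrib, hrow, hcol, add_zero]
  exact add_self_eq_zero.mp hdouble

theorem garnier_linear_relations (N : ℕ) (hN : 2 ≤ N) (t : Fin N → ℂ)
    (ht : Function.Injective t) (y p : Fin N → ℂ)
    (h0 : ∑ i, p i = 0) (h1 : ∑ i, p i * y i = 0) (h2 : ∑ i, p i * (y i) ^ 2 = 0) :
    (∑ i, evalYP y p (garnierHam t i) = 0) ∧
    (∑ i, t i * evalYP y p (garnierHam t i) = 0) ∧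
    (∑ i, (t i) ^ 2 * evalYP y p (garnierHam t i) = 0) := by
  have key := sum_mul_garnierHam_eq_zero t ht y p h0 h1 h2
  refine ⟨?_, key t (fun _ => -1 / 2) fun i j => by ring,
    key (fun i => t i ^ 2) (fun i => -t i) fun i j => by ring⟩
  simpa using key (fun _ => 1) (fun _ => 0) fun i j => by ring
end

section
/- Let n ≥ 1 be an integer, let a₁, ..., a_{2n−1} ∈ ℂ, and let f(z) := a₁ z + a₂ z² + ⋯ + a_{2n−1} z^{2n−1} ∈ ℂ[z]. Regard the 2×2 matrix M := [[1, f(z)], [0, z^{2n}]] as a matrix over the Laurent polynomial ring ℂ[z, z⁻¹]. Then the following are equivalent: (a) there exist a 2×2 matrix P over ℂ[z] whose determinant is a nonzero constant and a 2×2 matrix Q over ℂ[z⁻¹] whose determinant is a nonzero constant, such that M = z^n · P · Q in matrices over ℂ[z, z⁻¹]; (b) the Hankel determinant det( (a_{i+j−1})_{1 ≤ i, j ≤ n} ) is nonzero. -/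
open LaurentPolynomial

/-- The polynomial f(z) = a₁z + a₂z² + ⋯ + a_{2n−1}z^{2n−1}, as a Laurent polynomial
(here `a k` stands for the coefficient a_{k+1}). -/
noncomputable def fLaur (n : ℕ) (a : Fin (2 * n - 1) → ℂ) : LaurentPolynomial ℂ :=
  ∑ k : Fin (2 * n - 1), LaurentPolynomial.C (a k) * LaurentPolynomial.T (((k : ℕ) : ℤ) + 1)

/-- The transition matrix M = [[1, f(z)], [0, z^{2n}]] over ℂ[z,z⁻¹]. -/
noncomputable def transMat (n : ℕ) (a : Fin (2 * n - 1) → ℂ) :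
    Matrix (Fin 2) (Fin 2) (LaurentPolynomial ℂ) :=
  !![1, fLaur n a; 0, LaurentPolynomial.T (2 * (n : ℤ))]

/-- The Hankel matrix of (a₁,…,a_{2n−1}): its (i,j) entry (0-indexed) is a_{i+j+1},
i.e. a_{i+j−1} in 1-indexed notation. -/
noncomputable def hankelMat (n : ℕ) (a : Fin (2 * n - 1) → ℂ) : Matrix (Fin n) (Fin n) ℂ :=
  Matrix.of fun i j : Fin n =>
    a ⟨i.1 + j.1, by have hi := i.2; have hj := j.2; omega⟩

namespace LaurentPolynomial

variable {R : Type*}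

lemma coeff_toLaurent_natCast [Semiring R] (p : Polynomial R) (k : ℕ) :
    (Polynomial.toLaurent p).coeff (k : ℤ) = p.coeff k := by
  rw [coeff_toLaurent]
  exact Finsupp.mapDomain_apply Nat.cast_injective _ _

lemma coeff_toLaurent_of_neg [Semiring R] (p : Polynomial R) {k : ℤ} (hk : k < 0) :
    (Polynomial.toLaurent p).coeff k = 0 := by
  rw [coeff_toLaurent]
  refine Finsupp.mapDomain_of_notMem_range _ _ ?_
  rintro ⟨m, rfl⟩
  simp at hk
  omega

lemma coeff_trunc [Semiring R] (p : LaurentPolynomial R) (k : ℕ) :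
    (trunc p).coeff k = p.coeff (k : ℤ) := rfl

lemma toLaurent_trunc [Semiring R] {p : LaurentPolynomial R} (hp : ∀ k < 0, p.coeff k = 0) :
    Polynomial.toLaurent (trunc p) = p := by
  ext k
  rcases lt_or_ge k 0 with hk | hk
  · rw [coeff_toLaurent_of_neg _ hk, hp k hk]
  · lift k to ℕ using hk
    rw [coeff_toLaurent_natCast, coeff_trunc]

lemma coeff_mul_T [Semiring R] (p : LaurentPolynomial R) (m k : ℤ) :
    (p * T m).coeff k = p.coeff (k - m) := by
  rw [T, AddMonoidAlgebra.coeff_mul_single_apply, mul_one, sub_eq_add_neg]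

variable [CommSemiring R]

lemma aeval_T_neg_one (p : Polynomial R) :
    Polynomial.aeval (T (-1) : LaurentPolynomial R) p = invert (Polynomial.toLaurent p) := by
  induction p using Polynomial.induction_on' with
  | add p q hp hq => simp only [map_add, hp, hq]
  | monomial k r =>
    simp [Polynomial.aeval_monomial, ← C_eq_algebraMap]

lemma coeff_aeval_T_neg_one_of_pos (p : Polynomial R) {k : ℤ} (hk : 0 < k) :
    (Polynomial.aeval (T (-1) : LaurentPolynomial R) p).coeff k = 0 := by
  rw [aeval_T_neg_one, invert_apply, coeff_toLaurent_of_neg _ (by omega)]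

lemma toLaurent_reflect {p : Polynomial R} {N : ℕ} (hp : p.natDegree ≤ N) :
    Polynomial.toLaurent (p.reflect N) =
      Polynomial.aeval (T (-1) : LaurentPolynomial R) p * T N := by
  ext k
  rw [coeff_mul_T, aeval_T_neg_one, invert_apply]
  rcases lt_or_ge k 0 with hk | hk
  · rw [coeff_toLaurent_of_neg _ hk]
    obtain ⟨j, hj⟩ := Int.eq_ofNat_of_zero_le (a := -(k - N)) (by omega)
    rw [hj, coeff_toLaurent_natCast, Polynomial.coeff_eq_zero_of_natDegree_lt (by omega)]
  · lift k to ℕ using hk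
    rw [coeff_toLaurent_natCast, Polynomial.coeff_reflect]
    rcases le_or_gt k N with h | h
    · rw [Polynomial.revAt_le h, show -((k : ℤ) - N) = ((N - k : ℕ) : ℤ) by omega,
        coeff_toLaurent_natCast]
    · rw [Polynomial.revAt_eq_self_of_lt h, coeff_toLaurent_of_neg _ (by omega),
        Polynomial.coeff_eq_zero_of_natDegree_lt (by omega)]

lemma coeff_mul_aeval_T_neg_one (g : LaurentPolynomial R) {p : Polynomial R} {N : ℕ}
    (hp : p.natDegree < N) (m : ℤ) :
    (g * Polynomial.aeval (T (-1) : LaurentPolynomial R) p).coeff m =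
      ∑ k ∈ Finset.range N, p.coeff k * g.coeff (m + k) := by
  rw [Polynomial.aeval_eq_sum_range' hp, Finset.mul_sum, AddMonoidAlgebra.coeff_sum,
    Finset.sum_apply']
  refine Finset.sum_congr rfl fun k _ => ?_
  rw [mul_smul_comm, AddMonoidAlgebra.coeff_smul, T_pow, Finsupp.smul_apply, coeff_mul_T,
    smul_eq_mul]
  congr 2
  ring

/-- A Laurent polynomial without terms of degree strictly between `0` and `N` is the difference of
`z ^ N` times a polynomial in `z` and a polynomial in `z⁻¹`. -/
lemma exists_add_aeval_eq_toLaurent_mul_T {R : Type*} [CommRing R] (g : LaurentPolynomial R)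
    {N : ℤ} (hN : 0 < N) (hg : ∀ k, 0 < k → k < N → g.coeff k = 0) :
    ∃ A B : Polynomial R,
      Polynomial.aeval (T (-1) : LaurentPolynomial R) B + g = Polynomial.toLaurent A * T N := by
  classical
  let q : LaurentPolynomial R := .ofCoeff (g.coeff.filter (N ≤ ·))
  let r : LaurentPolynomial R := .ofCoeff (g.coeff.filter (· ≤ 0))
  have hqr : g = q + r := by
    ext k
    simp only [q, r, AddMonoidAlgebra.coeff_add,
      Finsupp.add_apply, Finsupp.filter_apply]
    rcases le_or_gt k 0 with h0 | h0
    · simp [h0, show ¬ N ≤ k by omega]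
    · rcases le_or_gt N k with h | h
      · simp [h, show ¬ k ≤ 0 by omega]
      · simp [hg k h0 h]
  have hq : Polynomial.toLaurent (trunc (q * T (-N))) = q * T (-N) := by
    refine toLaurent_trunc fun k hk => ?_
    rw [coeff_mul_T]
    exact Finsupp.filter_apply_neg _ _ (by omega)
  have hr : Polynomial.toLaurent (trunc (invert r)) = invert r := by
    refine toLaurent_trunc fun k hk => ?_
    rw [invert_apply]
    exact Finsupp.filter_apply_neg _ _ (by omega)
  refine ⟨trunc (q * T (-N)), -trunc (invert r), ?_⟩
  rw [map_neg, aeval_T_neg_one, hr, hq, hqr, mul_T_assoc, involutive_invert r]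
  simp

lemma aeval_T_neg_one_eq_toLaurent_iff {p q : Polynomial R} :
    Polynomial.aeval (T (-1) : LaurentPolynomial R) p = Polynomial.toLaurent q ↔
      ∃ c, p = Polynomial.C c ∧ q = Polynomial.C c := by
  refine ⟨fun h => ⟨q.coeff 0, ?_, ?_⟩, ?_⟩
  · ext k
    have hk := congr(($h).coeff (-(k : ℤ)))
    rw [aeval_T_neg_one, invert_apply, neg_neg, coeff_toLaurent_natCast] at hk
    rw [hk]
    rcases k with _ | k
    · simpa using coeff_toLaurent_natCast q 0
    · rw [coeff_toLaurent_of_neg _ (by omega), Polynomial.coeff_C_succ]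
  · ext k
    rcases k with _ | k
    · simp
    · have hk := congr(($h).coeff ((k + 1 : ℕ) : ℤ))
      rw [coeff_aeval_T_neg_one_of_pos _ (by omega), coeff_toLaurent_natCast] at hk
      rw [← hk, Polynomial.coeff_C_succ]
  · rintro ⟨c, rfl, rfl⟩
    simp [← C_eq_algebraMap]

/-- A polynomial in `z⁻¹` which is `z` times a polynomial in `z` vanishes. -/
lemma eq_zero_of_aeval_T_neg_one_eq_toLaurent_mul_T {p q : Polynomial R}
    (h : Polynomial.aeval (T (-1) : LaurentPolynomial R) p = Polynomial.toLaurent q * T 1) :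
    p = 0 := by
  rw [← Polynomial.toLaurent_X, ← map_mul, aeval_T_neg_one_eq_toLaurent_iff] at h
  obtain ⟨c, rfl, hc⟩ := h
  have : c = 0 := by simpa using congr(($hc).coeff 0).symm
  simp [this]

end LaurentPolynomial

lemma coeff_fLaur (n : ℕ) (a : Fin (2 * n - 1) → ℂ) (k : Fin (2 * n - 1)) :
    (fLaur n a).coeff ((k : ℕ) + 1 : ℤ) = a k := by
  rw [fLaur, AddMonoidAlgebra.coeff_sum, Finset.sum_apply', Finset.sum_eq_single k]
  · rw [coeff_mul_T]
    simp
  · intro j _ hj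
    rw [coeff_mul_T, C_apply, if_neg]
    have := Fin.val_ne_of_ne hj
    omega
  · simp

lemma coeff_fLaur_mul_aeval_ofFn (n : ℕ) (a : Fin (2 * n - 1) → ℂ) (x : Fin n → ℂ) (i : Fin n) :
    (fLaur n a * Polynomial.aeval (T (-1) : LaurentPolynomial ℂ)
      (Polynomial.ofFn n x)).coeff ((i : ℕ) + 1 : ℤ) = (hankelMat n a).mulVec x i := by
  have hn : 1 ≤ n := by have := i.2; omega
  rw [coeff_mul_aeval_T_neg_one _ (Polynomial.ofFn_natDegree_lt hn x), Finset.sum_range,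
    Matrix.mulVec, dotProduct]
  refine Finset.sum_congr rfl fun k _ => ?_
  rw [Polynomial.ofFn_coeff_eq_val_of_lt _ k.2, hankelMat, Matrix.of_apply, ← coeff_fLaur n a,
    mul_comm]
  congr 2
  push_cast
  ring

lemma hankelMat_det_ne_zero_of_factorization {n : ℕ} (hn : 1 ≤ n) {a : Fin (2 * n - 1) → ℂ}
    {P Q : Matrix (Fin 2) (Fin 2) (Polynomial ℂ)} {c d : ℂ} (hc : c ≠ 0) (hd : d ≠ 0)
    (hP : P.det = Polynomial.C c) (hQ : Q.det = Polynomial.C d)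
    (h : transMat n a = (T (n : ℤ) : LaurentPolynomial ℂ) •
      (P.map (Polynomial.toLaurent (R := ℂ)) *
        Q.map (Polynomial.aeval (T (-1) : LaurentPolynomial ℂ)))) :
    (hankelMat n a).det ≠ 0 := by
  intro hdet
  obtain ⟨x, hx0, hx⟩ := Matrix.exists_mulVec_eq_zero_iff.mpr hdet
  refine hx0 ?_
  set W := Polynomial.ofFn n x with hW
  have hWdeg : W.natDegree < n := Polynomial.ofFn_natDegree_lt hn x
  obtain ⟨A, U, hA⟩ := exists_add_aeval_eq_toLaurent_mul_T
    (fLaur n a * Polynomial.aeval (T (-1) : LaurentPolynomial ℂ) W) (N := n + 1) (by omega) (by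
      intro k hk hkn
      have := coeff_fLaur_mul_aeval_ofFn n a x ⟨(k - 1).toNat, by omega⟩
      rw [hx, Pi.zero_apply, ← hW] at this
      rw [← this]
      congr 1
      simp only
      omega)
  have hB := toLaurent_reflect (p := W) (N := n - 1) (by omega)
  set B := W.reflect (n - 1)
  have hT1 : (T ((n : ℤ) + 1) : LaurentPolynomial ℂ) = T n * T 1 := T_add _ _
  have hT2 : (T (2 * (n : ℤ)) : LaurentPolynomial ℂ) = T n * T n := by rw [two_mul, T_add]
  have hT3 : (T (n : ℤ) : LaurentPolynomial ℂ) = T ((n - 1 : ℕ) : ℤ) * T 1 := by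
    rw [← T_add]; congr 1; omega
  have hTn : IsUnit (T (n : ℤ) : LaurentPolynomial ℂ) := isUnit_T _
  rw [hT1] at hA
  have h00 := congr_fun₂ h 0 0
  have h01 := congr_fun₂ h 0 1
  have h10 := congr_fun₂ h 1 0
  have h11 := congr_fun₂ h 1 1
  simp only [transMat, Matrix.of_apply, Matrix.cons_val', Matrix.cons_val_zero,
    Matrix.cons_val_one, Matrix.cons_val_fin_one, Matrix.smul_apply, Matrix.mul_apply,
    Fin.sum_univ_two, Matrix.map_apply, smul_eq_mul, hT2] at h00 h01 h10 h11
  have hP' := congr(Polynomial.toLaurent $hP)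
  rw [Matrix.det_fin_two, Polynomial.toLaurent_C, map_sub, map_mul, map_mul] at hP'
  set φ := Polynomial.toLaurent (R := ℂ)
  set ψ := Polynomial.aeval (R := ℂ) (T (-1) : LaurentPolynomial ℂ) with hψ
  have e0 : φ (P 0 0) * ψ (Q 0 0 * U + Q 0 1 * W) + φ (P 0 1) * ψ (Q 1 0 * U + Q 1 1 * W) =
      φ A * T 1 := by
    refine hTn.mul_left_cancel ?_
    simp only [map_add, map_mul]
    linear_combination hA - ψ U * h00 - ψ W * h01
  have e1 : φ (P 1 0) * ψ (Q 0 0 * U + Q 0 1 * W) + φ (P 1 1) * ψ (Q 1 0 * U + Q 1 1 * W) =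
      φ B * T 1 := by
    refine hTn.mul_left_cancel ?_
    simp only [map_add, map_mul]
    linear_combination - ψ U * h10 - ψ W * h11 - T (n : ℤ) * T 1 * hB + T (n : ℤ) * ψ W * hT3
  have hψC : ψ (Polynomial.C c) = C c := by simp [hψ, ← C_eq_algebraMap]
  have hCc : Polynomial.C c ≠ 0 := by simpa using hc
  have hCd : Polynomial.C d ≠ 0 := by simpa using hd
  have r0 : Q 0 0 * U + Q 0 1 * W = 0 := by
    refine (mul_eq_zero.mp (eq_zero_of_aeval_T_neg_one_eq_toLaurent_mul_T
      (q := P 1 1 * A - P 0 1 * B) (p := Polynomial.C c * (Q 0 0 * U + Q 0 1 * W))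
      ?_)).resolve_left hCc
    rw [← hψ, map_mul, hψC, map_sub, map_mul, map_mul]
    linear_combination φ (P 1 1) * e0 - φ (P 0 1) * e1 - ψ (Q 0 0 * U + Q 0 1 * W) * hP'
  have r1 : Q 1 0 * U + Q 1 1 * W = 0 := by
    refine (mul_eq_zero.mp (eq_zero_of_aeval_T_neg_one_eq_toLaurent_mul_T
      (q := P 0 0 * B - P 1 0 * A) (p := Polynomial.C c * (Q 1 0 * U + Q 1 1 * W))
      ?_)).resolve_left hCc
    rw [← hψ, map_mul, hψC, map_sub, map_mul, map_mul]
    linear_combination φ (P 0 0) * e1 - φ (P 1 0) * e0 - ψ (Q 1 0 * U + Q 1 1 * W) * hP'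
  have hW0 : W = 0 := by
    rw [Matrix.det_fin_two] at hQ
    refine (mul_eq_zero.mp (?_ : Polynomial.C d * W = 0)).resolve_left hCd
    linear_combination Q 0 0 * r1 - Q 1 0 * r0 - W * hQ
  ext k
  have := Polynomial.ofFn_coeff_eq_val_of_lt x k.2
  rw [← hW, hW0] at this
  simpa using this.symm

/-- A polynomial `W` in `z⁻¹` of degree at most `n`, for which `f * W` has no terms of degree
strictly between `0` and `n`, is the second entry of a vector over `ℂ[z⁻¹]` which
`z ^ (-n) * M` maps to a vector over `ℂ[z]`. -/
lemma exists_transMat_lift {n : ℕ} (hn : 1 ≤ n) (a : Fin (2 * n - 1) → ℂ) {W : Polynomial ℂ}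
    (hW : W.natDegree ≤ n)
    (h : ∀ k : ℤ, 0 < k → k < n →
      (fLaur n a * Polynomial.aeval (T (-1) : LaurentPolynomial ℂ) W).coeff k = 0) :
    ∃ A B U : Polynomial ℂ,
      Polynomial.aeval (T (-1) : LaurentPolynomial ℂ) U +
        fLaur n a * Polynomial.aeval (T (-1) : LaurentPolynomial ℂ) W =
          Polynomial.toLaurent A * T n ∧
      Polynomial.aeval (T (-1) : LaurentPolynomial ℂ) W * T n = Polynomial.toLaurent B ∧
      A.coeff 0 =
        (fLaur n a * Polynomial.aeval (T (-1) : LaurentPolynomial ℂ) W).coeff (n : ℤ) ∧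
      B.coeff 0 = W.coeff n := by
  obtain ⟨A, U, hA⟩ := exists_add_aeval_eq_toLaurent_mul_T _ (by omega) h
  refine ⟨A, W.reflect n, U, hA, (toLaurent_reflect hW).symm, ?_, ?_⟩
  · have := congr(($hA).coeff (n : ℤ))
    rw [AddMonoidAlgebra.coeff_add, Finsupp.add_apply, coeff_aeval_T_neg_one_of_pos _ (by omega),
      zero_add, coeff_mul_T, sub_self] at this
    rw [this, ← coeff_toLaurent_natCast, Nat.cast_zero]
  · rw [Polynomial.coeff_reflect, Polynomial.revAt_le (Nat.zero_le n), Nat.sub_zero]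

lemma exists_factorization_of_hankelMat_det_ne_zero {n : ℕ} (hn : 1 ≤ n)
    {a : Fin (2 * n - 1) → ℂ} (h : (hankelMat n a).det ≠ 0) :
    ∃ P Q : Matrix (Fin 2) (Fin 2) (Polynomial ℂ), P.det = 1 ∧ Q.det = 1 ∧
      transMat n a = (T (n : ℤ) : LaurentPolynomial ℂ) •
        (P.map (Polynomial.toLaurent (R := ℂ)) *
          Q.map (Polynomial.aeval (T (-1) : LaurentPolynomial ℂ))) := by
  have hsurj : Function.Surjective (hankelMat n a).mulVec :=
    Matrix.mulVec_surjective_iff_isUnit.mpr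
      ((Matrix.isUnit_iff_isUnit_det _).mpr (isUnit_iff_ne_zero.mpr h))
  obtain ⟨x, hx⟩ := hsurj (Pi.single ⟨n - 1, by omega⟩ 1)
  obtain ⟨y, hy⟩ := hsurj fun i => -(fLaur n a).coeff ((i : ℕ) + 1 + n : ℤ)
  have hxdeg := Polynomial.ofFn_natDegree_lt hn x
  have hydeg := Polynomial.ofFn_natDegree_lt hn y
  have hxf (k : ℤ) (hk : 0 < k) (hkn : k ≤ n) : (fLaur n a * Polynomial.aeval
      (T (-1) : LaurentPolynomial ℂ) (Polynomial.ofFn n x)).coeff k = if k = n then 1 else 0 := by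
    have := coeff_fLaur_mul_aeval_ofFn n a x ⟨(k - 1).toNat, by omega⟩
    rw [show (((k - 1).toNat : ℕ) + 1 : ℤ) = k by omega, hx, Pi.single_apply] at this
    rw [this]
    congr 1
    simp only [Fin.mk.injEq, eq_iff_iff]
    omega
  have hyf (k : ℤ) (hk : 0 < k) (hkn : k ≤ n) : (fLaur n a * Polynomial.aeval
      (T (-1) : LaurentPolynomial ℂ) (Polynomial.X ^ n + Polynomial.ofFn n y)).coeff k = 0 := by
    have := coeff_fLaur_mul_aeval_ofFn n a y ⟨(k - 1).toNat, by omega⟩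
    rw [hy] at this
    simp only [show (((k - 1).toNat : ℕ) + 1 : ℤ) = k by omega] at this
    rw [map_add, mul_add, AddMonoidAlgebra.coeff_add, Finsupp.add_apply, this, map_pow,
      Polynomial.aeval_X, T_pow, coeff_mul_T]
    simp
  obtain ⟨A₀, B₀, U₀, hA₀, hB₀, hA₀', hB₀'⟩ := exists_transMat_lift hn a hxdeg.le
    fun k hk hkn => by rw [hxf k hk hkn.le, if_neg hkn.ne]
  obtain ⟨A₁, B₁, U₁, hA₁, hB₁, hA₁', hB₁'⟩ := exists_transMat_lift hn a
    (W := Polynomial.X ^ n + Polynomial.ofFn n y)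
    (Polynomial.natDegree_add_le_of_degree_le (by simp) hydeg.le)
    fun k hk hkn => hyf k hk hkn.le
  rw [hxf n (by omega) le_rfl, if_pos rfl] at hA₀'
  rw [hyf n (by omega) le_rfl] at hA₁'
  rw [Polynomial.coeff_eq_zero_of_natDegree_lt hxdeg] at hB₀'
  rw [Polynomial.coeff_add, Polynomial.coeff_X_pow_self,
    Polynomial.coeff_eq_zero_of_natDegree_lt hydeg, add_zero] at hB₁'
  set W₀ := Polynomial.ofFn n x
  set W₁ := Polynomial.X ^ n + Polynomial.ofFn n y
  have hTn : IsUnit (T (n : ℤ) : LaurentPolynomial ℂ) := isUnit_T _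
  have hT2 : (T (2 * (n : ℤ)) : LaurentPolynomial ℂ) = T n * T n := by rw [two_mul, T_add]
  have hdet : Polynomial.aeval (T (-1) : LaurentPolynomial ℂ) (U₀ * W₁ - U₁ * W₀) =
      Polynomial.toLaurent (A₀ * B₁ - A₁ * B₀) := by
    refine hTn.mul_left_cancel ?_
    simp only [map_sub, map_mul, ← hB₀, ← hB₁]
    linear_combination T (n : ℤ) *
      (Polynomial.aeval (T (-1) : LaurentPolynomial ℂ) W₁ * hA₀ -
        Polynomial.aeval (T (-1) : LaurentPolynomial ℂ) W₀ * hA₁)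
  obtain ⟨c, hQ, hP⟩ := aeval_T_neg_one_eq_toLaurent_iff.mp hdet
  have hc : c = 1 := by
    have := congr(($hP).coeff 0)
    simpa [Polynomial.mul_coeff_zero, hA₀', hA₁', hB₀', hB₁'] using this.symm
  rw [hc, Polynomial.C_1] at hQ hP
  have hQ' := congr(Polynomial.aeval (T (-1) : LaurentPolynomial ℂ) $hQ)
  rw [map_sub, map_mul, map_mul, map_one] at hQ'
  refine ⟨!![A₀, A₁; B₀, B₁], !![W₁, -U₁; -W₀, U₀], ?_, ?_, ?_⟩
  · rw [Matrix.det_fin_two_of, hP]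
  · rw [Matrix.det_fin_two_of, ← hQ]
    ring
  · refine Matrix.ext fun i j => ?_
    fin_cases i <;> fin_cases j <;>
      simp only [transMat, Matrix.of_apply, Matrix.cons_val', Matrix.cons_val_zero,
        Matrix.cons_val_one, Matrix.cons_val_fin_one, Matrix.smul_apply, Matrix.mul_apply,
        Fin.sum_univ_two, Matrix.map_apply, smul_eq_mul, hT2, map_neg, ← hB₀, ← hB₁,
        Fin.zero_eta, Fin.mk_one]
    · linear_combination Polynomial.aeval (T (-1) : LaurentPolynomial ℂ) W₁ * hA₀ -
        Polynomial.aeval (T (-1) : LaurentPolynomial ℂ) W₀ * hA₁ - hQ'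
    · linear_combination Polynomial.aeval (T (-1) : LaurentPolynomial ℂ) U₀ * hA₁ -
        Polynomial.aeval (T (-1) : LaurentPolynomial ℂ) U₁ * hA₀ - fLaur n a * hQ'
    · ring
    · linear_combination -(T (n : ℤ) * T (n : ℤ)) * hQ'

theorem birkhoff_factorization_iff_hankel (n : ℕ) (hn : 1 ≤ n)
    (a : Fin (2 * n - 1) → ℂ) :
    (∃ P Q : Matrix (Fin 2) (Fin 2) (Polynomial ℂ),
      (∃ c : ℂ, c ≠ 0 ∧ P.det = Polynomial.C c) ∧
      (∃ c : ℂ, c ≠ 0 ∧ Q.det = Polynomial.C c) ∧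
      transMat n a =
        (LaurentPolynomial.T (n : ℤ) : LaurentPolynomial ℂ) •
          (P.map (Polynomial.toLaurent (R := ℂ)) *
            Q.map (Polynomial.aeval (LaurentPolynomial.T (-1) : LaurentPolynomial ℂ)))) ↔
    (hankelMat n a).det ≠ 0 := by
  refine ⟨?_, fun h => ?_⟩
  · rintro ⟨P, Q, ⟨c, hc, hP⟩, ⟨d, hd, hQ⟩, h⟩
    exact hankelMat_det_ne_zero_of_factorization hn hc hd hP hQ h
  · obtain ⟨P, Q, hP, hQ, h⟩ := exists_factorization_of_hankelMat_det_ne_zero hn h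
    exact ⟨P, Q, ⟨1, one_ne_zero, by rw [hP, Polynomial.C_1]⟩,
      ⟨1, one_ne_zero, by rw [hQ, Polynomial.C_1]⟩, h⟩
end
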